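/- Let 0 < p < 1/2 and let E₁* be the unique bounded solution of E(q) = 1 + r(q)·E(f₁(q)) on [0,1]. Then the set of points of [0,1] at which E₁* is discontinuous is dense in [0,1]; in particular, E₁* is not differentiable at any point of [0,1]. -/

import Mathlib

noncomputable section

/-- The rescaling map `f₁`. -/
def f1 (p q : ℝ) : ℝ :=
  if q ≤ p then q / p
  else if q < 1 - p then (q - p) / (1 - p)
  else (q - (1 - p)) / p

/-- The continuation probability `r`. -/
def r (p q : ℝ) : ℝ := if p < q ∧ q < 1 - p then 1 - p else p

/-- The unique bounded solution of `E(q) = 1 + r(q)·E(f₁(q))`, given by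
`E₁*(q) = Σ_{n=0}^∞ Π_{j=0}^{n-1} r(f₁^j(q))`. -/
def E1star (p q : ℝ) : ℝ := ∑' n : ℕ, ∏ j ∈ Finset.range n, r p ((f1 p)^[j] q)

section

variable {p : ℝ}

theorem r_mem_Icc (hp' : p < 1 / 2) (q : ℝ) : r p q ∈ Set.Icc p (1 - p) := by
  unfold r
  split_ifs <;> constructor <;> linarith

theorem summable_prod_r (hp : 0 < p) (hp' : p < 1 / 2) (q : ℝ) :
    Summable fun n : ℕ => ∏ j ∈ Finset.range n, r p ((f1 p)^[j] q) := by
  refine Summable.of_nonneg_of_le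
    (fun n => Finset.prod_nonneg fun j _ => hp.le.trans (r_mem_Icc hp' _).1) (fun n => ?_)
    (summable_geometric_of_lt_one (r := 1 - p) (by linarith) (by linarith))
  simpa using Finset.prod_le_prod (s := Finset.range n)
    (fun j _ => hp.le.trans (r_mem_Icc hp' ((f1 p)^[j] q)).1)
    (fun j _ => (r_mem_Icc hp' ((f1 p)^[j] q)).2)

theorem E1star_eq (hp : 0 < p) (hp' : p < 1 / 2) (q : ℝ) :
    E1star p q = 1 + r p q * E1star p (f1 p q) := by
  unfold E1star
  rw [(summable_prod_r hp hp' q).tsum_eq_zero_add, ← tsum_mul_left]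
  simp [Finset.prod_range_succ', mul_comm]

theorem inv_one_sub_le_E1star (hp : 0 < p) (hp' : p < 1 / 2) (q : ℝ) :
    (1 - p)⁻¹ ≤ E1star p q := by
  rw [← tsum_geometric_of_lt_one hp.le (by linarith)]
  refine Summable.tsum_le_tsum (fun n => ?_)
    (summable_geometric_of_lt_one hp.le (by linarith)) (summable_prod_r hp hp' q)
  simpa using Finset.prod_le_prod (s := Finset.range n) (fun j _ => hp.le)
    (fun j _ => (r_mem_Icc hp' ((f1 p)^[j] q)).1)

theorem E1star_left (hp : 0 < p) (hp' : p < 1 / 2) {q : ℝ} (hq : q ≤ p) :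
    E1star p q = 1 + p * E1star p (q / p) := by
  rw [E1star_eq hp hp', r, f1, if_neg (by grind), if_pos hq]

theorem E1star_middle (hp : 0 < p) (hp' : p < 1 / 2) {q : ℝ} (hq : p < q) (hq' : q < 1 - p) :
    E1star p q = 1 + (1 - p) * E1star p ((q - p) / (1 - p)) := by
  rw [E1star_eq hp hp', r, f1, if_pos ⟨hq, hq'⟩, if_neg hq.not_ge, if_pos hq']

theorem E1star_right (hp : 0 < p) (hp' : p < 1 / 2) {q : ℝ} (hq : 1 - p ≤ q) :
    E1star p q = 1 + p * E1star p ((q - (1 - p)) / p) := by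
  rw [E1star_eq hp hp', r, f1, if_neg (by grind), if_neg (by linarith), if_neg hq.not_gt]

theorem E1star_apply_left_breakpoint (hp : 0 < p) (hp' : p < 1 / 2) :
    E1star p p = (1 - p)⁻¹ := by
  have h := E1star_right hp hp' (q := 1) (by linarith)
  rw [show (1 - (1 - p)) / p = 1 by field_simp; ring] at h
  rw [E1star_left hp hp' le_rfl, div_self hp.ne']
  rw [← h]
  exact eq_inv_of_mul_eq_one_left (by linarith)

theorem E1star_apply_right_breakpoint (hp : 0 < p) (hp' : p < 1 / 2) :
    E1star p (1 - p) = (1 - p)⁻¹ := by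
  have h := E1star_left hp hp' (q := 0) hp.le
  rw [zero_div] at h
  rw [E1star_right hp hp' le_rfl, sub_self, zero_div]
  rw [← h]
  exact eq_inv_of_mul_eq_one_left (by linarith)

theorem two_le_E1star (hp : 0 < p) (hp' : p < 1 / 2) {q : ℝ} (hq : p < q) (hq' : q < 1 - p) :
    2 ≤ E1star p q := by
  have h0 : 0 < 1 - p := by linarith
  have h := mul_le_mul_of_nonneg_left
    (inv_one_sub_le_E1star hp hp' ((q - p) / (1 - p))) h0.le
  rw [mul_inv_cancel₀ h0.ne'] at h
  rw [E1star_middle hp hp' hq hq']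
  linarith

/-- The interval `(a, b)` contains a point where `f` jumps upwards by at least `c * (b - a)`. -/
def HasJump (f : ℝ → ℝ) (c a b : ℝ) : Prop :=
  ∃ x ∈ Set.Ioo a b, ∀ δ > 0, ∃ y ∈ Set.Ioo a b, |y - x| < δ ∧ f x + c * (b - a) ≤ f y

theorem HasJump.of_affine {f : ℝ → ℝ} {c a b s t : ℝ} (hs : 0 < s)
    (hf : ∀ x ∈ Set.Ioo a b, f x = 1 + s * f ((x - t) / s))
    (h : HasJump f c ((a - t) / s) ((b - t) / s)) : HasJump f c a b := by
  have key : ∀ x ∈ Set.Ioo ((a - t) / s) ((b - t) / s),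
      s * x + t ∈ Set.Ioo a b ∧ f (s * x + t) = 1 + s * f x := by
    rintro x ⟨h₁, h₂⟩
    rw [div_lt_iff₀ hs] at h₁
    rw [lt_div_iff₀ hs] at h₂
    have hm : s * x + t ∈ Set.Ioo a b := ⟨by linarith, by linarith⟩
    refine ⟨hm, ?_⟩
    rw [hf _ hm, add_sub_cancel_right, mul_div_cancel_left₀ _ hs.ne']
  obtain ⟨x, hx, h⟩ := h
  refine ⟨s * x + t, (key x hx).1, fun δ hδ => ?_⟩
  obtain ⟨y, hy, hyx, hj⟩ := h (δ / s) (by positivity)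
  refine ⟨s * y + t, (key y hy).1, ?_, ?_⟩
  · rw [show s * y + t - (s * x + t) = s * (y - x) by ring, abs_mul, abs_of_pos hs]
    rwa [lt_div_iff₀' hs] at hyx
  · rw [(key x hx).2, (key y hy).2]
    have h₁ := mul_le_mul_of_nonneg_left hj hs.le
    have h₂ : s * (f x + c * ((b - t) / s - (a - t) / s)) = s * f x + c * (b - a) := by
      field_simp
      ring
    linarith

theorem inv_one_sub_lt_two (hp' : p < 1 / 2) : (1 - p)⁻¹ < 2 := by
  rw [inv_lt_comm₀ (by linarith) two_pos]
  linarith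

theorem hasJump_left_breakpoint (hp : 0 < p) (hp' : p < 1 / 2) {a b : ℝ} (hab : b - a ≤ 1)
    (ha : a < p) (hb : p < b) : HasJump (E1star p) (2 - (1 - p)⁻¹) a b := by
  refine ⟨p, ⟨ha, hb⟩, fun δ hδ => ?_⟩
  obtain ⟨y, hy, hy'⟩ := exists_between
    (show p < min b (min (1 - p) (p + δ)) by
      refine lt_min hb (lt_min ?_ ?_) <;> linarith)
  simp only [lt_min_iff] at hy'
  refine ⟨y, ⟨by linarith, hy'.1⟩, ?_, ?_⟩
  · rw [abs_of_pos] <;> linarith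
  · rw [E1star_apply_left_breakpoint hp hp']
    nlinarith [two_le_E1star hp hp' hy hy'.2.1, inv_one_sub_lt_two hp']

theorem hasJump_right_breakpoint (hp : 0 < p) (hp' : p < 1 / 2) {a b : ℝ} (hab : b - a ≤ 1)
    (ha : a < 1 - p) (hb : 1 - p < b) : HasJump (E1star p) (2 - (1 - p)⁻¹) a b := by
  refine ⟨1 - p, ⟨ha, hb⟩, fun δ hδ => ?_⟩
  obtain ⟨y, hy, hy'⟩ := exists_between
    (show max a (max p (1 - p - δ)) < 1 - p by
      refine max_lt ha (max_lt ?_ ?_) <;> linarith)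
  simp only [max_lt_iff] at hy
  refine ⟨y, ⟨hy.1, by linarith⟩, ?_, ?_⟩
  · rw [abs_of_neg] <;> linarith
  · rw [E1star_apply_right_breakpoint hp hp']
    nlinarith [two_le_E1star hp hp' hy.2.1 hy', inv_one_sub_lt_two hp']

theorem hasJump_of_pow_le (hp : 0 < p) (hp' : p < 1 / 2) (n : ℕ) :
    ∀ a b : ℝ, 0 ≤ a → b ≤ 1 → (1 - p) ^ n ≤ b - a →
      HasJump (E1star p) (2 - (1 - p)⁻¹) a b := by
  have h0 : 0 < 1 - p := by linarith
  induction n with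
  | zero =>
    intro a b ha hb h
    rw [pow_zero] at h
    exact hasJump_left_breakpoint hp hp' (by linarith) (by linarith) (by linarith)
  | succ n ih =>
    intro a b ha hb h
    have hlen : 0 < b - a := (pow_pos h0 _).trans_le h
    have step : ∀ s t : ℝ, 0 < s → s ≤ 1 - p → t ≤ a → b ≤ s + t →
        (∀ x ∈ Set.Ioo a b, E1star p x = 1 + s * E1star p ((x - t) / s)) →
        HasJump (E1star p) (2 - (1 - p)⁻¹) a b := by
      intro s t hs hsp hta hbt hE
      refine HasJump.of_affine hs hE (ih _ _ (div_nonneg (by linarith) hs.le) ?_ ?_)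
      · rw [div_le_one hs]
        linarith
      · rw [← sub_div, sub_sub_sub_cancel_right, le_div_iff₀ hs]
        calc (1 - p) ^ n * s ≤ (1 - p) ^ n * (1 - p) := by gcongr
          _ ≤ b - a := by rwa [← pow_succ]
    by_cases hbp : b ≤ p
    · refine step p 0 hp (by linarith) ha (by linarith) fun x hx => ?_
      rw [sub_zero, E1star_left hp hp' (hx.2.le.trans hbp)]
    by_cases hap : a < p
    · exact hasJump_left_breakpoint hp hp' (by linarith) hap (not_le.1 hbp)
    by_cases hbq : b ≤ 1 - p
    · exact step (1 - p) p h0 le_rfl (not_lt.1 hap) (by linarith) fun x hx =>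
        E1star_middle hp hp' ((not_lt.1 hap).trans_lt hx.1) (hx.2.trans_le hbq)
    by_cases haq : a < 1 - p
    · exact hasJump_right_breakpoint hp hp' (by linarith) haq (not_le.1 hbq)
    · exact step p (1 - p) hp (by linarith) (not_lt.1 haq) (by linarith) fun x hx =>
        E1star_right hp hp' ((not_lt.1 haq).trans hx.1.le)

theorem hasJump_E1star (hp : 0 < p) (hp' : p < 1 / 2) {a b : ℝ} (ha : 0 ≤ a) (hb : b ≤ 1)
    (hab : a < b) : HasJump (E1star p) (2 - (1 - p)⁻¹) a b := by
  obtain ⟨n, hn⟩ := exists_pow_lt_of_lt_one (sub_pos.2 hab) (show 1 - p < 1 by linarith)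
  exact hasJump_of_pow_le hp hp' n a b ha hb hn.le

theorem HasJump.exists_not_continuousWithinAt {f : ℝ → ℝ} {c a b : ℝ} {S : Set ℝ} (hc : 0 < c)
    (hS : Set.Ioo a b ⊆ S) (h : HasJump f c a b) :
    ∃ x ∈ Set.Ioo a b, ¬ ContinuousWithinAt f S x := by
  obtain ⟨x, hx, h⟩ := h
  refine ⟨x, hx, fun hcont => ?_⟩
  have hpos : 0 < c * (b - a) := mul_pos hc (by linarith [hx.1, hx.2])
  obtain ⟨δ, hδ, hf⟩ := Metric.continuousWithinAt_iff.1 hcont _ hpos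
  obtain ⟨y, hy, hyx, hj⟩ := h δ hδ
  have := hf (hS hy) (by rwa [Real.dist_eq])
  rw [Real.dist_eq] at this
  linarith [le_abs_self (f y - f x)]

/-- A function with a jump is not uniformly well approximated by an affine function. -/
theorem HasJump.not_affine_approx {f : ℝ → ℝ} {c a b q D : ℝ} (hc : 0 < c) (h : HasJump f c a b)
    (hf : ∀ y ∈ Set.Ioo a b, |f y - f q - (y - q) * D| ≤ c / 4 * (b - a)) : False := by
  obtain ⟨x, hx, h⟩ := h
  have hpos : 0 < c * (b - a) := mul_pos hc (by linarith [hx.1, hx.2])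
  obtain ⟨y, hy, hyx, hj⟩ := h (c * (b - a) / (4 * (|D| + 1))) (by positivity)
  rw [lt_div_iff₀ (by positivity)] at hyx
  have h₁ := abs_le.1 (hf x hx)
  have h₂ := abs_le.1 (hf y hy)
  have h₃ : (y - x) * D ≤ |y - x| * |D| := by
    rw [← abs_mul]
    exact le_abs_self _
  linarith [h₁.1, h₂.2, abs_nonneg (y - x)]

end

/-- the set of points of `[0,1]` at which `E₁*` is discontinuous
(within `[0,1]`) is dense in `[0,1]`; in particular `E₁*` is not differentiable
(within `[0,1]`) at any point of `[0,1]`. -/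
theorem E1star_dense_discontinuities_nowhere_differentiable
    (p : ℝ) (hp : 0 < p) (hp' : p < 1 / 2) :
    Set.Icc (0:ℝ) 1 ⊆
      closure {q ∈ Set.Icc (0:ℝ) 1 | ¬ ContinuousWithinAt (E1star p) (Set.Icc 0 1) q} ∧
    ∀ q ∈ Set.Icc (0:ℝ) 1, ¬ DifferentiableWithinAt ℝ (E1star p) (Set.Icc 0 1) q := by
  have hc : 0 < 2 - (1 - p)⁻¹ := sub_pos.2 (inv_one_sub_lt_two hp')
  constructor
  · intro q hq
    rw [Metric.mem_closure_iff]
    intro ε hε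
    have hab : max 0 (q - ε) < min 1 (q + ε) := by
      refine max_lt (lt_min ?_ ?_) (lt_min ?_ ?_) <;> linarith [hq.1, hq.2]
    have hS : Set.Ioo (max 0 (q - ε)) (min 1 (q + ε)) ⊆ Set.Icc 0 1 :=
      (Set.Ioo_subset_Ioo (le_max_left _ _) (min_le_left _ _)).trans Set.Ioo_subset_Icc_self
    obtain ⟨x, hx, hx'⟩ := (hasJump_E1star hp hp' (le_max_left _ _) (min_le_left _ _)
      hab).exists_not_continuousWithinAt hc hS
    refine ⟨x, ⟨hS hx, hx'⟩, ?_⟩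
    simp only [Set.mem_Ioo, max_lt_iff, lt_min_iff] at hx
    rw [Real.dist_eq, abs_sub_lt_iff]
    constructor <;> linarith
  · intro q hq hd
    have ho := (hasDerivWithinAt_iff_isLittleO.1 hd.hasDerivWithinAt).bound
      (show 0 < (2 - (1 - p)⁻¹) / 4 by positivity)
    obtain ⟨ε, hε, hb⟩ := Metric.mem_nhdsWithin_iff.1 ho
    have hab : max 0 (q - ε) < min 1 (q + ε) := by
      refine max_lt (lt_min ?_ ?_) (lt_min ?_ ?_) <;> linarith [hq.1, hq.2]
    refine (hasJump_E1star hp hp' (le_max_left _ _) (min_le_left _ _) hab).not_affine_approx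
      (q := q) (D := derivWithin (E1star p) (Set.Icc 0 1) q) hc fun y hy => ?_
    have hqa : max 0 (q - ε) ≤ q := max_le hq.1 (by linarith)
    have hqb : q ≤ min 1 (q + ε) := le_min hq.2 (by linarith)
    have hle : |y - q| ≤ min 1 (q + ε) - max 0 (q - ε) := by
      rw [abs_sub_le_iff]
      constructor <;> linarith [hy.1, hy.2]
    simp only [Set.mem_Ioo, max_lt_iff, lt_min_iff] at hy
    have hball : y ∈ Metric.ball q ε := by
      rw [Metric.mem_ball, Real.dist_eq, abs_sub_lt_iff]
      constructor <;> linarith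
    have := hb ⟨hball, hy.1.1.le, hy.2.1.le⟩
    simp only [Set.mem_ofPred_eq, Real.norm_eq_abs, smul_eq_mul] at this
    exact this.trans (mul_le_mul_of_nonneg_left hle (by positivity))
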